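/- arXiv:1408.0589 — 3 statements merged into one kernel-verified Lean document; each statement's English description precedes it below -/
import Mathlib

section
/- Let X be a quasiparabolic W-set that is bounded below. Then any two bar operators on ℳ are equal, any two bar operators on 𝒩 are equal, and every bar operator on ℳ (respectively, on 𝒩) is an involution, i.e. β ∘ β is the identity map. -/
noncomputable section

open LaurentPolynomial

/-- The Laurent polynomial ring `A = ℤ[v,v⁻¹]`. -/
abbrev A : Type := LaurentPolynomial ℤ

/-- The element `v`. -/
def v : A := T 1

/-- The element `v⁻¹`. -/
def vinv : A := T (-1)

/-- The bar involution of `A`, sending `v ↦ v⁻¹`. -/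
def Abar : A → A := LaurentPolynomial.invert

/-- The set `v⁻¹·ℤ[v⁻¹] ⊆ A`. -/
def negPart : Set A := { f | ∃ p : Polynomial ℤ, f = Polynomial.aeval vinv (Polynomial.X * p) }

variable {B W : Type*} [Group W] {M : CoxeterMatrix B} {X : Type*}

/-- `σ : W → X → X` is a group action of `W` on `X`. -/
def IsActionOf (σ : W → X → X) : Prop :=
  (∀ x, σ 1 x = x) ∧ ∀ w w' x, σ (w * w') x = σ w (σ w' x)

/-- `(X, ht)` is a scaled `W`-set (relative to the action `σ`). -/
def IsScaled (cs : CoxeterSystem M W) (σ : W → X → X) (ht : X → ℚ) : Prop :=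
  ∀ (i : B) (x : X), ht (σ (cs.simple i) x) - ht x ∈ ({-1, 0, 1} : Set ℚ)

/-- `(X, ht)` is a quasiparabolic `W`-set. -/
def IsQP (cs : CoxeterSystem M W) (σ : W → X → X) (ht : X → ℚ) : Prop :=
  IsScaled cs σ ht ∧
  (∀ r : W, cs.IsReflection r → ∀ x : X, ht (σ r x) = ht x → σ r x = x) ∧
  (∀ r : W, cs.IsReflection r → ∀ (x : X) (i : B),
      ht x < ht (σ r x) → ht (σ (cs.simple i) (σ r x)) < ht (σ (cs.simple i) x) →
      σ r x = σ (cs.simple i) x)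

/-- `x` is a `W`-minimal element of `X`. -/
def WMin (cs : CoxeterSystem M W) (σ : W → X → X) (ht : X → ℚ) (x : X) : Prop :=
  ∀ i : B, ht x ≤ ht (σ (cs.simple i) x)

/-- Every `W`-orbit of `X` contains a `W`-minimal element. -/
def BoundedBelow (cs : CoxeterSystem M W) (σ : W → X → X) (ht : X → ℚ) : Prop :=
  ∀ x : X, ∃ w : W, WMin cs σ ht (σ w x)

/-- The strict Bruhat order on a quasiparabolic set. -/
def bruhatLT (cs : CoxeterSystem M W) (σ : W → X → X) (ht : X → ℚ) : X → X → Prop :=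
  Relation.TransGen fun a b => ∃ r : W, cs.IsReflection r ∧ b = σ r a ∧ ht a < ht b

/-- The standard basis element `M_x` (also `N_x`) of the free `A`-module on `X`. -/
def Mstd (x : X) : X →₀ A := Finsupp.single x 1

/-- The operator `T_s` on the module `ℳ`. -/
def Ts (cs : CoxeterSystem M W) (σ : W → X → X) (ht : X → ℚ) (i : B) :
    (X →₀ A) →ₗ[A] (X →₀ A) :=
  Finsupp.lift (X →₀ A) A X fun x =>
    if ht x < ht (σ (cs.simple i) x) then Mstd (σ (cs.simple i) x)
    else if ht (σ (cs.simple i) x) < ht x then Mstd (σ (cs.simple i) x) + (v - vinv) • Mstd x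
    else v • Mstd x

/-- The operator `U_s` on the module `𝒩`. -/
def Us (cs : CoxeterSystem M W) (σ : W → X → X) (ht : X → ℚ) (i : B) :
    (X →₀ A) →ₗ[A] (X →₀ A) :=
  Finsupp.lift (X →₀ A) A X fun x =>
    if ht x < ht (σ (cs.simple i) x) then Mstd (σ (cs.simple i) x)
    else if ht (σ (cs.simple i) x) < ht x then Mstd (σ (cs.simple i) x) + (v - vinv) • Mstd x
    else (-vinv) • Mstd x

/-- A bar operator on the module `ℳ`. -/
def IsBarOpM (cs : CoxeterSystem M W) (σ : W → X → X) (ht : X → ℚ)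
    (β : (X →₀ A) → (X →₀ A)) : Prop :=
  (∀ m m', β (m + m') = β m + β m') ∧
  (∀ (f : A) (m : X →₀ A), β (f • m) = Abar f • β m) ∧
  (∀ (i : B) (m : X →₀ A), β (Ts cs σ ht i m) = Ts cs σ ht i (β m) + (vinv - v) • β m) ∧
  (∀ x : X, WMin cs σ ht x → β (Mstd x) = Mstd x)

/-- A bar operator on the module `𝒩`. -/
def IsBarOpN (cs : CoxeterSystem M W) (σ : W → X → X) (ht : X → ℚ)
    (β : (X →₀ A) → (X →₀ A)) : Prop :=
  (∀ n n', β (n + n') = β n + β n') ∧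
  (∀ (f : A) (n : X →₀ A), β (f • n) = Abar f • β n) ∧
  (∀ (i : B) (n : X →₀ A), β (Us cs σ ht i n) = Us cs σ ht i (β n) + (vinv - v) • β n) ∧
  (∀ x : X, WMin cs σ ht x → β (Mstd x) = Mstd x)


/-- A single covering step of the Bruhat order on a quasiparabolic set. -/
def BruhatStep (cs : CoxeterSystem M W) (σ : W → X → X) (ht : X → ℚ) (a b : X) : Prop :=
  ∃ r : W, cs.IsReflection r ∧ b = σ r a ∧ ht a < ht b

theorem IsActionOf.simple_simple {σ : W → X → X} (hact : IsActionOf σ)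
    (cs : CoxeterSystem M W) (i : B) (x : X) :
    σ (cs.simple i) (σ (cs.simple i) x) = x := by
  rw [← hact.2, cs.simple_mul_simple_self, hact.1]

/-- Applying a simple reflection to both ends of a Bruhat step preserves it, unless it swaps
the two ends. -/
theorem BruhatStep.simple {cs : CoxeterSystem M W} {σ : W → X → X} {ht : X → ℚ}
    (hact : IsActionOf σ) (hqp : IsQP cs σ ht) {a b : X} (h : BruhatStep cs σ ht a b) (i : B) :
    BruhatStep cs σ ht (σ (cs.simple i) a) (σ (cs.simple i) b) ∨ σ (cs.simple i) b = a := by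
  obtain ⟨r, hr, rfl, hlt⟩ := h
  have hr' : cs.IsReflection (cs.simple i * r * (cs.simple i)⁻¹) := hr.conj _
  have hconj : σ (cs.simple i * r * (cs.simple i)⁻¹) (σ (cs.simple i) a)
      = σ (cs.simple i) (σ r a) := by
    rw [← hact.2, ← hact.2]
    simp
  rcases lt_trichotomy (ht (σ (cs.simple i) a)) (ht (σ (cs.simple i) (σ r a))) with hc | hc | hc
  · exact Or.inl ⟨_, hr', hconj.symm, hc⟩
  · have h1 := hqp.2.1 _ hr' (σ (cs.simple i) a) (by rw [hconj, hc])
    rw [hconj] at h1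
    have h2 := congrArg (σ (cs.simple i)) h1
    rw [hact.simple_simple, hact.simple_simple] at h2
    rw [h2] at hlt
    exact absurd hlt (lt_irrefl _)
  · right
    rw [hqp.2.2 r hr a i hlt hc, hact.simple_simple]

/-- In the Bruhat order, a `W`-minimal element stays below after applying a simple reflection. -/
theorem WMin.bruhat_le_simple {cs : CoxeterSystem M W} {σ : W → X → X} {ht : X → ℚ}
    (hact : IsActionOf σ) (hqp : IsQP cs σ ht) {x₀ : X} (hx₀ : WMin cs σ ht x₀) (i : B) {y : X}
    (h : Relation.ReflTransGen (BruhatStep cs σ ht) x₀ y) :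
    Relation.ReflTransGen (BruhatStep cs σ ht) x₀ (σ (cs.simple i) y) := by
  induction h with
  | refl =>
    rcases (hx₀ i).lt_or_eq with hlt | heq
    · exact .single ⟨_, cs.isReflection_simple i, rfl, hlt⟩
    · rw [hqp.2.1 _ (cs.isReflection_simple i) x₀ heq.symm]
  | tail hab hbc ih =>
    rcases hbc.simple hact hqp i with h | h
    · exact ih.tail h
    · rwa [h]

/-- A `W`-minimal element is below every element of its orbit in the Bruhat order. -/
theorem WMin.bruhat_le {cs : CoxeterSystem M W} {σ : W → X → X} {ht : X → ℚ}
    (hact : IsActionOf σ) (hqp : IsQP cs σ ht) {x₀ : X} (hx₀ : WMin cs σ ht x₀) (w : W) :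
    Relation.ReflTransGen (BruhatStep cs σ ht) x₀ (σ w x₀) := by
  induction w using cs.simple_induction_left with
  | one => rw [hact.1]
  | mul_simple_left w i ih =>
    rw [hact.2]
    exact hx₀.bruhat_le_simple hact hqp i ih

/-- A `W`-minimal element has the least height in its orbit. -/
theorem WMin.ht_le {cs : CoxeterSystem M W} {σ : W → X → X} {ht : X → ℚ}
    (hact : IsActionOf σ) (hqp : IsQP cs σ ht) {x₀ : X} (hx₀ : WMin cs σ ht x₀) (w : W) :
    ht x₀ ≤ ht (σ w x₀) := by
  have h := hx₀.bruhat_le hact hqp w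
  generalize σ w x₀ = y at h ⊢
  induction h with
  | refl => exact le_rfl
  | tail _ h ih =>
    obtain ⟨_, _, _, hlt⟩ := h
    exact ih.trans hlt.le

/-- Induction along ascending simple reflections, starting from the `W`-minimal elements. -/
theorem BoundedBelow.induction {cs : CoxeterSystem M W} {σ : W → X → X} {ht : X → ℚ}
    (hact : IsActionOf σ) (hqp : IsQP cs σ ht) (hbb : BoundedBelow cs σ ht) {P : X → Prop}
    (hmin : ∀ x, WMin cs σ ht x → P x)
    (hstep : ∀ i x, ht x < ht (σ (cs.simple i) x) → P x → P (σ (cs.simple i) x)) (x : X) :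
    P x := by
  obtain ⟨w, hw⟩ := hbb x
  set x₀ := σ w x with hx₀
  have key : ∀ (n : ℕ) (u : W), ht (σ u x₀) < ht x₀ + n → P (σ u x₀) := by
    intro n
    induction n with
    | zero =>
      intro u hu
      have := hw.ht_le hact hqp u
      simp only [Nat.cast_zero, add_zero] at hu
      exact absurd hu this.not_gt
    | succ n ih =>
      intro u hu
      by_cases hy : WMin cs σ ht (σ u x₀)
      · exact hmin _ hy
      · simp only [WMin, not_forall, not_le] at hy
        obtain ⟨i, hi⟩ := hy
        have hs := hqp.1 i (σ u x₀)
        simp only [Set.mem_insert_iff, Set.mem_singleton_iff] at hs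
        push_cast at hu
        have hlt : ht (σ (cs.simple i) (σ u x₀)) < ht x₀ + n := by
          rcases hs with h | h | h <;> linarith
        have hP := ih (cs.simple i * u) (by rwa [hact.2])
        rw [hact.2] at hP
        have := hstep i _ (by rwa [hact.simple_simple]) hP
        rwa [hact.simple_simple] at this
  obtain ⟨n, hn⟩ := exists_nat_gt (ht x - ht x₀)
  have hx : σ w⁻¹ x₀ = x := by rw [hx₀, ← hact.2, inv_mul_cancel, hact.1]
  have := key n w⁻¹ (by rw [hx]; linarith)
  rwa [hx] at this

theorem Abar_Abar (f : A) : Abar (Abar f) = f :=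
  involutive_invert f

theorem Abar_vinv_sub_v : Abar (vinv - v) = v - vinv := by
  simp [Abar, v, vinv]

/-- Semilinear maps on `X →₀ A` which agree on the standard basis are equal. -/
theorem eq_of_semilinear {c : A → A} {β β' : (X →₀ A) → (X →₀ A)}
    (hadd : ∀ m m', β (m + m') = β m + β m') (hsmul : ∀ (f : A) m, β (f • m) = c f • β m)
    (hadd' : ∀ m m', β' (m + m') = β' m + β' m') (hsmul' : ∀ (f : A) m, β' (f • m) = c f • β' m)
    (h : ∀ x, β (Mstd x) = β' (Mstd x)) : β = β' := by
  let F : (X →₀ A) →+ (X →₀ A) := AddMonoidHom.mk' β hadd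
  let F' : (X →₀ A) →+ (X →₀ A) := AddMonoidHom.mk' β' hadd'
  have hF : F = F' := by
    refine Finsupp.addHom_ext fun x f => ?_
    have hs : Finsupp.single x f = f • (Mstd x : X →₀ A) := by simp [Mstd]
    change β _ = β' _
    rw [hs, hsmul, hsmul', h]
  exact funext fun m => DFunLike.congr_fun hF m

/-- Bar operators compatible with a family of operators that send `M_x` to `M_{s x}` at ascents
are unique. -/
theorem bar_unique {cs : CoxeterSystem M W} {σ : W → X → X} {ht : X → ℚ}
    (hact : IsActionOf σ) (hqp : IsQP cs σ ht) (hbb : BoundedBelow cs σ ht)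
    (Φ : B → (X →₀ A) →ₗ[A] (X →₀ A))
    (hΦ : ∀ i x, ht x < ht (σ (cs.simple i) x) → Φ i (Mstd x) = Mstd (σ (cs.simple i) x))
    {β β' : (X →₀ A) → (X →₀ A)}
    (hadd : ∀ m m', β (m + m') = β m + β m') (hsmul : ∀ (f : A) m, β (f • m) = Abar f • β m)
    (hop : ∀ i m, β (Φ i m) = Φ i (β m) + (vinv - v) • β m)
    (hmin : ∀ x, WMin cs σ ht x → β (Mstd x) = Mstd x)
    (hadd' : ∀ m m', β' (m + m') = β' m + β' m')
    (hsmul' : ∀ (f : A) m, β' (f • m) = Abar f • β' m)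
    (hop' : ∀ i m, β' (Φ i m) = Φ i (β' m) + (vinv - v) • β' m)
    (hmin' : ∀ x, WMin cs σ ht x → β' (Mstd x) = Mstd x) : β = β' := by
  refine eq_of_semilinear hadd hsmul hadd' hsmul' fun x => ?_
  induction x using hbb.induction hact hqp with
  | hmin x hx => rw [hmin x hx, hmin' x hx]
  | hstep i x hx ih => rw [← hΦ i x hx, hop, hop', ih]

/-- Bar operators compatible with a family of operators that send `M_x` to `M_{s x}` at ascents
are involutions. -/
theorem bar_involutive {cs : CoxeterSystem M W} {σ : W → X → X} {ht : X → ℚ}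
    (hact : IsActionOf σ) (hqp : IsQP cs σ ht) (hbb : BoundedBelow cs σ ht)
    (Φ : B → (X →₀ A) →ₗ[A] (X →₀ A))
    (hΦ : ∀ i x, ht x < ht (σ (cs.simple i) x) → Φ i (Mstd x) = Mstd (σ (cs.simple i) x))
    {β : (X →₀ A) → (X →₀ A)}
    (hadd : ∀ m m', β (m + m') = β m + β m') (hsmul : ∀ (f : A) m, β (f • m) = Abar f • β m)
    (hop : ∀ i m, β (Φ i m) = Φ i (β m) + (vinv - v) • β m)
    (hmin : ∀ x, WMin cs σ ht x → β (Mstd x) = Mstd x) : Function.Involutive β := by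
  refine congrFun (eq_of_semilinear (c := id) (β := fun m => β (β m)) (β' := fun m => m)
    (fun m m' => ?_) (fun f m => ?_) (fun _ _ => rfl) (fun _ _ => rfl) fun x => ?_)
  · simp only [hadd]
  · simp only [hsmul, Abar_Abar, id]
  · induction x using hbb.induction hact hqp with
    | hmin x hx => simp only [hmin x hx]
    | hstep i x hx ih =>
      rw [← hΦ i x hx, hop, hadd, hsmul, hop, ih, Abar_vinv_sub_v, add_assoc, ← add_smul]
      simp

theorem Ts_Mstd_of_lt (cs : CoxeterSystem M W) (σ : W → X → X) (ht : X → ℚ) (i : B) (x : X)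
    (h : ht x < ht (σ (cs.simple i) x)) :
    Ts cs σ ht i (Mstd x) = Mstd (σ (cs.simple i) x) := by
  simp [Ts, Mstd, h]

theorem Us_Mstd_of_lt (cs : CoxeterSystem M W) (σ : W → X → X) (ht : X → ℚ) (i : B) (x : X)
    (h : ht x < ht (σ (cs.simple i) x)) :
    Us cs σ ht i (Mstd x) = Mstd (σ (cs.simple i) x) := by
  simp [Us, Mstd, h]

/-- If the quasiparabolic `W`-set `X` is bounded below, then any two bar
operators on `ℳ` (resp. on `𝒩`) are equal, and every bar operator on `ℳ` (resp. on `𝒩`)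
is an involution. -/
theorem stmt1 (cs : CoxeterSystem M W) (σ : W → X → X) (ht : X → ℚ)
    (hact : IsActionOf σ) (hqp : IsQP cs σ ht) (hbb : BoundedBelow cs σ ht) :
    (∀ β β' : (X →₀ A) → (X →₀ A),
        IsBarOpM cs σ ht β → IsBarOpM cs σ ht β' → β = β') ∧
    (∀ β : (X →₀ A) → (X →₀ A), IsBarOpM cs σ ht β → ∀ m, β (β m) = m) ∧
    (∀ β β' : (X →₀ A) → (X →₀ A),
        IsBarOpN cs σ ht β → IsBarOpN cs σ ht β' → β = β') ∧
    (∀ β : (X →₀ A) → (X →₀ A), IsBarOpN cs σ ht β → ∀ n, β (β n) = n) := by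
  exact ⟨fun _ _ ⟨h₁, h₂, h₃, h₄⟩ ⟨h₁', h₂', h₃', h₄'⟩ =>
      bar_unique hact hqp hbb _ (Ts_Mstd_of_lt cs σ ht) h₁ h₂ h₃ h₄ h₁' h₂' h₃' h₄',
    fun _ ⟨h₁, h₂, h₃, h₄⟩ =>
      bar_involutive hact hqp hbb _ (Ts_Mstd_of_lt cs σ ht) h₁ h₂ h₃ h₄,
    fun _ _ ⟨h₁, h₂, h₃, h₄⟩ ⟨h₁', h₂', h₃', h₄'⟩ =>
      bar_unique hact hqp hbb _ (Us_Mstd_of_lt cs σ ht) h₁ h₂ h₃ h₄ h₁' h₂' h₃' h₄',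
    fun _ ⟨h₁, h₂, h₃, h₄⟩ =>
      bar_involutive hact hqp hbb _ (Us_Mstd_of_lt cs σ ht) h₁ h₂ h₃ h₄⟩

end
end

section
/- Let X be a quasiparabolic W-set that is bounded below, and let β be a bar operator on ℳ. Then for every x ∈ X, the element β(M_x) − M_x is supported on {w ∈ X : w < x}, where < denotes the strict Bruhat order on X; i.e., β(M_x) lies in M_x plus the A-span of {M_w : w < x}. The analogous statement holds for a bar operator on 𝒩 and the basis (N_x). -/
noncomputable section

open LaurentPolynomial

variable {B W : Type*} [Group W] {M : CoxeterMatrix B} {X : Type*}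

/-- The structure of a quasiparabolic `W`-set that only remembers the action `s` of the simple
generators and the relation `ρ` of being exchanged by a reflection. -/
structure ReflGraph (s : B → X → X) (ρ : X → X → Prop) (ht : X → ℚ) : Prop where
  invol : ∀ i x, s i (s i x) = x
  simple : ∀ i x, ρ x (s i x)
  symm : ∀ {x y}, ρ x y → ρ y x
  map : ∀ i {x y}, ρ x y → ρ (s i x) (s i y)
  scaled : ∀ i x, ht (s i x) = ht x - 1 ∨ ht (s i x) = ht x ∨ ht (s i x) = ht x + 1
  eq_of_ht : ∀ {x y}, ρ x y → ht y = ht x → y = x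
  exchange : ∀ {x y} i, ρ x y → ht x < ht y → ht (s i y) < ht (s i x) → y = s i x

/-- `altAct s p q n x` applies to `x` the alternating word `p q p ⋯` of length `n`. -/
def altAct (s : B → X → X) : B → B → ℕ → X → X
  | _, _, 0, x => x
  | p, q, n + 1, x => s p (altAct s q p n x)

/-- `x` is obtained from `x₀` by applying `n` simple generators. -/
inductive ReachIn (s : B → X → X) (x₀ : X) : ℕ → X → Prop
  | zero : ReachIn s x₀ 0 x₀
  | succ {n : ℕ} {x : X} (i : B) : ReachIn s x₀ n x → ReachIn s x₀ (n + 1) (s i x)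

theorem ReachIn.altAct {s : B → X → X} {x₀ b : X} {k : ℕ} (hb : ReachIn s x₀ k b) (p q : B)
    (n : ℕ) : ReachIn s x₀ (k + n) (altAct s p q n b) := by
  induction n generalizing p q with
  | zero => exact hb
  | succ n ih => exact .succ p (ih q p)

namespace ReflGraph

variable {s : B → X → X} {ρ : X → X → Prop} {ht : X → ℚ}

theorem fixed_of_ht_eq (h : ReflGraph s ρ ht) {i : B} {x : X} (hx : ht (s i x) = ht x) :
    s i x = x :=
  h.eq_of_ht (h.simple i x) hx

theorem ht_simple_le (h : ReflGraph s ρ ht) (i : B) (x : X) : ht (s i x) ≤ ht x + 1 := by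
  rcases h.scaled i x with e | e | e <;> linarith

theorem ht_eq_sub_one (h : ReflGraph s ρ ht) {i : B} {x : X} (hx : ht (s i x) < ht x) :
    ht (s i x) = ht x - 1 := by
  rcases h.scaled i x with e | e | e <;> linarith

theorem ht_altAct_le (h : ReflGraph s ρ ht) (p q : B) (n : ℕ) (b : X) :
    ht (altAct s p q n b) ≤ ht b + n := by
  induction n generalizing p q with
  | zero => simp [altAct]
  | succ n ih =>
    have := h.ht_simple_le p (altAct s q p n b)
    have := ih q p
    rw [altAct]; push_cast; linarith

theorem ht_altAct_pred (h : ReflGraph s ρ ht) {p q : B} {n : ℕ} {b : X}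
    (e : ht (altAct s p q (n + 1) b) = ht b + (n + 1 : ℕ)) :
    ht (altAct s q p n b) = ht b + n := by
  have h1 := h.ht_simple_le p (altAct s q p n b)
  have h2 := h.ht_altAct_le q p n b
  rw [altAct] at e; push_cast at e; linarith

theorem rel_altAct (h : ReflGraph s ρ ht) (p q : B) (n : ℕ) (b : X) :
    ρ (altAct s p q n b) (altAct s p q (n + 1) b) := by
  induction n generalizing p q with
  | zero => exact h.simple p b
  | succ n ih => exact h.map p (ih q p)

/-- Above an element at which both `p` and `q` ascend, the two alternating paths ascend at the
same rate. -/
theorem ht_altAct_swap (h : ReflGraph s ρ ht) {b : X} {n : ℕ} {p q : B}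
    (hp : ht b < ht (s p b)) (hq : ht b < ht (s q b))
    (e : ht (altAct s p q n b) = ht b + n) : ht (altAct s q p n b) = ht b + n := by
  induction n generalizing p q with
  | zero => simp [altAct]
  | succ n ih =>
    cases n with
    | zero =>
      rcases h.scaled q b with e | e | e
      · linarith
      · linarith
      · simp [altAct, e]
    | succ m =>
      have a1 := h.ht_altAct_pred e
      have a0 := h.ht_altAct_pred a1
      have c1 := ih hq hp a1
      have hρ := h.rel_altAct p q m b
      have hρ' := h.map q hρ
      have key : altAct s p q (m + 1) b ≠ altAct s q p (m + 1) b := by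
        intro heq
        have h1 : altAct s p q (m + 2) b = altAct s q p m b := by
          rw [altAct, ← heq, altAct, h.invol]
        have h2 := h.ht_altAct_le q p m b
        rw [← h1, e] at h2
        push_cast at h2; linarith
      rcases h.scaled q (altAct s p q (m + 1) b) with e' | e' | e'
      · refine absurd (h.exchange q hρ (by rw [a0, c1]; push_cast; linarith) ?_) key
        change _ < ht (altAct s q p (m + 1) b)
        rw [e', a1, c1]; linarith
      · refine absurd ?_ key
        rw [← h.fixed_of_ht_eq e']
        exact h.eq_of_ht hρ' (by rw [e', c1]; exact a1.symm)
      · rw [altAct, e', c1]; push_cast; ring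

theorem altAct_succ_eq_of_fixed (h : ReflGraph s ρ ht) {b : X} {n : ℕ} {p q : B}
    (hb : s p b = b ∨ s q b = b) (e : ht (altAct s p q (n + 1) b) = ht b + (n + 1 : ℕ)) :
    altAct s q p (n + 1) b = altAct s q p n b := by
  induction n generalizing p q with
  | zero =>
    rcases hb with hb | hb
    · simp [altAct, hb] at e
    · exact hb
  | succ n ih =>
    have := ih hb.symm (h.ht_altAct_pred e)
    rw [altAct, this, altAct]

/-- If the generator continuing an ascending alternating path descends, then the element it
reaches is also the endpoint of a shorter alternating path from the same starting point. -/
theorem exists_altAct_eq_of_descent (h : ReflGraph s ρ ht) {b : X} {n : ℕ} {p q : B}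
    (hp : ht b ≤ ht (s p b)) (hq : ht b ≤ ht (s q b))
    (e : ht (altAct s p q (n + 1) b) = ht b + (n + 1 : ℕ))
    (hd : ht (s q (altAct s p q (n + 1) b)) < ht (altAct s p q (n + 1) b)) :
    ∃ p' q', s q (altAct s p q (n + 1) b) = altAct s p' q' n b := by
  have hρ := h.rel_altAct p q n b
  by_cases hb : s p b = b ∨ s q b = b
  · refine ⟨q, p, ?_⟩
    have hfix := h.altAct_succ_eq_of_fixed hb e
    rw [← hfix]
    refine h.eq_of_ht (h.map q hρ) ?_
    rw [hfix, h.ht_altAct_pred e, h.ht_eq_sub_one hd, e]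
    push_cast; ring
  · push Not at hb
    refine ⟨p, q, ?_⟩
    have hp' := lt_of_le_of_ne hp fun e => hb.1 (h.fixed_of_ht_eq e.symm)
    have hq' := lt_of_le_of_ne hq fun e => hb.2 (h.fixed_of_ht_eq e.symm)
    have c := h.ht_altAct_swap hp' hq' e
    have := h.exchange q hρ
      (by have := h.ht_altAct_le p q n b; rw [e]; push_cast; linarith)
      (by change _ < ht (altAct s q p (n + 1) b); rw [c, ← e]; exact hd)
    rw [this, h.invol]

/-- Descending alternately along `p` and `q` ends at an element where neither descends. -/
theorem exists_altAct_of_reachIn (h : ReflGraph s ρ ht) {x₀ : X} {k : ℕ}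
    (hk : ∀ n ≤ k, ∀ x, ReachIn s x₀ n x → ∃ j ≤ n, ReachIn s x₀ j x ∧ ht x = ht x₀ + j)
    {n : ℕ} (hn : n < k) {z : X} (hz : ReachIn s x₀ n z) (e : ht z = ht x₀ + n) {p q : B}
    (hq : ht z ≤ ht (s q z)) :
    ∃ m l b, m + l = n ∧ z = altAct s p q m b ∧ ReachIn s x₀ l b ∧ ht b = ht x₀ + l ∧
      ht b ≤ ht (s p b) ∧ ht b ≤ ht (s q b) := by
  induction n generalizing z p q with
  | zero =>
    refine ⟨0, 0, z, rfl, rfl, hz, e, ?_, hq⟩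
    obtain ⟨j, -, -, hj⟩ := hk 1 hn _ (hz.succ p)
    rw [hj, e]; simp
  | succ n ih =>
    by_cases hp : ht z ≤ ht (s p z)
    · exact ⟨0, n + 1, z, by simp, rfl, hz, e, hp, hq⟩
    · push Not at hp
      have e1 := h.ht_eq_sub_one hp
      obtain ⟨j, -, hj, hj'⟩ := hk _ hn _ (hz.succ p)
      have : j = n := by
        have : (j : ℚ) = n := by rw [e1, e] at hj'; push_cast at hj'; linarith
        exact_mod_cast this
      subst this
      obtain ⟨m, l, b, hml, hb, hl, he, hb1, hb2⟩ :=
        ih (by omega) hj hj' (p := q) (q := p) (by rw [h.invol]; exact hp.le)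
      exact ⟨m + 1, l, b, by omega, by rw [altAct, ← hb, h.invol], hl, he, hb2, hb1⟩

/-- An element reachable from a minimal element `x₀` is reachable by an ascending path. -/
theorem exists_reachIn_ht_eq (h : ReflGraph s ρ ht) {x₀ : X} (h₀ : ∀ i, ht x₀ ≤ ht (s i x₀))
    {n : ℕ} {x : X} (hx : ReachIn s x₀ n x) :
    ∃ j ≤ n, ReachIn s x₀ j x ∧ ht x = ht x₀ + j := by
  induction n using Nat.strong_induction_on generalizing x with
  | _ n ih =>
    cases hx with
    | zero => exact ⟨0, le_rfl, .zero, by simp⟩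
    | @succ k y q hy =>
      obtain ⟨j, hjk, hj, hj'⟩ := ih k (by omega) hy
      rcases hjk.lt_or_eq with hlt | rfl
      · obtain ⟨i, hi, hi'⟩ := ih (j + 1) (by omega) (hj.succ q)
        exact ⟨i, by omega, hi'⟩
      rcases h.scaled q y with e | e | e
      · cases hj with
        | zero => have := h₀ q; linarith
        | @succ k y' p hy' =>
          obtain ⟨i, hik, -, hi⟩ := ih k (by omega) hy'
          have hyk : ht y' = ht x₀ + k := by
            have := h.ht_simple_le p y'
            have : (i : ℚ) ≤ k := by exact_mod_cast hik
            push_cast at hj'; linarith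
          obtain ⟨m, l, b, hml, hb, hl, he, hbq, hbp⟩ :=
            h.exists_altAct_of_reachIn (k := k + 1) (fun n hn x hx => ih n (by omega) hx)
              (by omega) hy' hyk (p := q) (q := p) (by rw [hj', hyk]; push_cast; linarith)
          have hy : s p y' = altAct s p q (m + 1) b := by rw [altAct, ← hb]
          have hkl : (k : ℚ) = m + l := by exact_mod_cast hml.symm
          obtain ⟨p', q', hx⟩ := h.exists_altAct_eq_of_descent (n := m) hbp hbq
            (by rw [← hy, hj', he]; push_cast; linarith) (by rw [← hy, e]; linarith)
          have hr := hl.altAct p' q' m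
          rw [← hx, ← hy] at hr
          obtain ⟨i, hi, hi'⟩ := ih (l + m) (by omega) hr
          exact ⟨i, by omega, hi'⟩
      · rw [h.fixed_of_ht_eq e]
        exact ⟨j, by omega, hj, hj'⟩
      · exact ⟨j + 1, le_rfl, hj.succ q, by rw [e, hj']; push_cast; ring⟩

/-- The lifting property: an ascending generator preserves strict comparisons. -/
theorem transGen_simple (h : ReflGraph s ρ ht) {w y : X} (i : B) (hy : ht y < ht (s i y))
    (hw : Relation.TransGen (fun a b => ρ a b ∧ ht a < ht b) w y) :
    Relation.TransGen (fun a b => ρ a b ∧ ht a < ht b) (s i w) (s i y) := by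
  have hyy : Relation.TransGen (fun a b => ρ a b ∧ ht a < ht b) y (s i y) :=
    .single ⟨h.simple i y, hy⟩
  have step : ∀ {a b}, ρ a b → ht a < ht b → b = s i a ∨
      Relation.TransGen (fun a b => ρ a b ∧ ht a < ht b) (s i a) (s i b) := by
    intro a b hab hlt
    rcases lt_trichotomy (ht (s i a)) (ht (s i b)) with hs | hs | hs
    · exact .inr (.single ⟨h.map i hab, hs⟩)
    · have := congrArg (s i) (h.eq_of_ht (h.map i hab) hs.symm)
      rw [h.invol, h.invol] at this
      exact absurd hlt (by rw [this]; exact lt_irrefl _)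
    · exact .inl (h.exchange i hab hlt hs)
  induction hw using Relation.TransGen.head_induction_on with
  | single hab =>
    rcases step hab.1 hab.2 with e | e
    · rwa [← e]
    · exact e
  | head hab hbc ih =>
    rcases step hab.1 hab.2 with e | e
    · rw [← e]; exact hbc.trans hyy
    · exact e.trans ih

/-- An additive map fixing the minimal basis elements and compatible with operators
`M_x ↦ F i x` is unitriangular for the Bruhat order on the elements reachable from a minimal
element. -/
theorem support_bar (h : ReflGraph s ρ ht) {F : B → X → (X →₀ A)}
    (hup : ∀ i x, ht x < ht (s i x) → F i x = Mstd (s i x))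
    (hsupp : ∀ i x w, F i x w ≠ 0 → w = x ∨ w = s i x)
    {β : (X →₀ A) → (X →₀ A)}
    (hβ : ∀ i m, β (Finsupp.lift (X →₀ A) A X (F i) m) =
      Finsupp.lift (X →₀ A) A X (F i) (β m) + (vinv - v) • β m)
    (hmin : ∀ x, (∀ i, ht x ≤ ht (s i x)) → β (Mstd x) = Mstd x)
    {x₀ : X} (h₀ : ∀ i, ht x₀ ≤ ht (s i x₀)) {n : ℕ} {x : X} (hx : ReachIn s x₀ n x)
    {w : X} (hw : (β (Mstd x) - Mstd x) w ≠ 0) :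
    Relation.TransGen (fun a b => ρ a b ∧ ht a < ht b) w x := by
  obtain ⟨j, -, hj, hj'⟩ := h.exists_reachIn_ht_eq h₀ hx
  clear hx
  induction j generalizing x w with
  | zero =>
    cases hj
    rw [hmin _ h₀, sub_self] at hw
    exact absurd rfl hw
  | succ k ih =>
    cases hj with
    | @succ k y i hy =>
    obtain ⟨l, hl, -, hl'⟩ := h.exists_reachIn_ht_eq h₀ hy
    have hyk : ht y = ht x₀ + k := by
      have := h.ht_simple_le i y
      have : (l : ℚ) ≤ k := by exact_mod_cast hl
      push_cast at hj'; linarith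
    have hlt : ht y < ht (s i y) := by rw [hj', hyk]; push_cast; linarith
    have hys : Relation.TransGen (fun a b => ρ a b ∧ ht a < ht b) y (s i y) :=
      .single ⟨h.simple i y, hlt⟩
    have hT : ∀ z, Finsupp.lift (X →₀ A) A X (F i) (Mstd z) = F i z := by
      intro z; simp [Mstd]
    have hbar := hβ i (Mstd y)
    rw [hT, hup i y hlt] at hbar
    set L := β (Mstd y) - Mstd y with hL
    have hβy : β (Mstd y) = Mstd y + L := by rw [hL]; abel
    rw [hβy, map_add, hT, hup i y hlt] at hbar
    have hdiff : β (Mstd (s i y)) - Mstd (s i y) =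
        Finsupp.lift (X →₀ A) A X (F i) L + (vinv - v) • L + (vinv - v) • Mstd y := by
      rw [hbar, smul_add]; abel
    rw [hdiff] at hw
    by_cases hwy : w = y
    · rw [hwy]; exact hys
    by_cases hwL : L w = 0
    · have : (Finsupp.lift (X →₀ A) A X (F i) L) w ≠ 0 := by
        rw [Finsupp.add_apply, Finsupp.add_apply, Finsupp.smul_apply, Finsupp.smul_apply, hwL,
          Mstd, Finsupp.single_eq_of_ne hwy] at hw
        simpa only [smul_zero, add_zero] using hw
      rw [Finsupp.lift_apply, Finsupp.sum, Finsupp.finsetSum_apply] at this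
      obtain ⟨z, hz, hzw⟩ := Finset.exists_ne_zero_of_sum_ne_zero this
      have hzy := ih (Finsupp.mem_support_iff.1 hz) hy hyk
      have hF : F i z w ≠ 0 := fun h0 => hzw (by simp [h0])
      rcases hsupp i z w hF with rfl | rfl
      · exact hzy.trans hys
      · exact h.transGen_simple i hlt hzy
    · exact (ih hwL hy hyk).trans hys

end ReflGraph

theorem IsQP.reflGraph {cs : CoxeterSystem M W} {σ : W → X → X} {ht : X → ℚ}
    (hact : IsActionOf σ) (hqp : IsQP cs σ ht) :
    ReflGraph (fun i => σ (cs.simple i)) (fun x y => ∃ r, cs.IsReflection r ∧ y = σ r x) ht where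
  invol i x := by rw [← hact.2, cs.simple_mul_simple_self, hact.1]
  simple i x := ⟨_, cs.isReflection_simple i, rfl⟩
  symm := by
    rintro x _ ⟨r, hr, rfl⟩
    exact ⟨r, hr, by rw [← hact.2, hr.mul_self, hact.1]⟩
  map := by
    rintro i x _ ⟨r, hr, rfl⟩
    exact ⟨_, hr.conj (cs.simple i), by simp [← hact.2, mul_assoc]⟩
  scaled i x := by
    have := hqp.1 i x
    simp only [Set.mem_insert_iff, Set.mem_singleton_iff] at this
    rcases this with e | e | e
    · left; linarith
    · right; left; linarith
    · right; right; linarith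
  eq_of_ht := by
    rintro x _ ⟨r, hr, rfl⟩ e
    exact hqp.2.1 r hr x e
  exchange := by
    rintro x _ i ⟨r, hr, rfl⟩ h1 h2
    exact hqp.2.2 r hr x i h1 h2

theorem IsActionOf.exists_reachIn {cs : CoxeterSystem M W} {σ : W → X → X}
    (hact : IsActionOf σ) (w : W) (x : X) :
    ∃ n, ReachIn (fun i => σ (cs.simple i)) x n (σ w x) := by
  induction w using cs.simple_induction_left with
  | one => exact ⟨0, by rw [hact.1]; exact .zero⟩
  | mul_simple_left w i ih =>
    obtain ⟨n, hn⟩ := ih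
    exact ⟨n + 1, by rw [hact.2]; exact hn.succ i⟩

/-- Unitriangularity of the bar operator for the Hecke algebra action in which `T_s` acts by the
scalar `c` on the basis elements fixed by `s`. -/
theorem bruhatLT_of_bar_apply_ne_zero (cs : CoxeterSystem M W) (σ : W → X → X) (ht : X → ℚ)
    (hact : IsActionOf σ) (hqp : IsQP cs σ ht) (hbb : BoundedBelow cs σ ht) (c : A)
    {β : (X →₀ A) → (X →₀ A)}
    (hβ : ∀ (i : B) (m : X →₀ A),
      let T := Finsupp.lift (X →₀ A) A X fun x =>
        if ht x < ht (σ (cs.simple i) x) then Mstd (σ (cs.simple i) x)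
        else if ht (σ (cs.simple i) x) < ht x then
          Mstd (σ (cs.simple i) x) + (v - vinv) • Mstd x
        else c • Mstd x
      β (T m) = T (β m) + (vinv - v) • β m)
    (hmin : ∀ x : X, WMin cs σ ht x → β (Mstd x) = Mstd x) {x w : X}
    (hw : (β (Mstd x) - Mstd x) w ≠ 0) : bruhatLT cs σ ht w x := by
  obtain ⟨u, hu⟩ := hbb x
  obtain ⟨n, hn⟩ := hact.exists_reachIn (cs := cs) u⁻¹ (σ u x)
  rw [← hact.2, inv_mul_cancel, hact.1] at hn
  have := (hqp.reflGraph hact).support_bar (fun i x hx => if_pos hx) ?_ hβ hmin hu hn hw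
  · refine Relation.TransGen.mono ?_ _ _ this
    rintro a b ⟨⟨r, hr, hb⟩, hlt⟩
    exact ⟨r, hr, hb, hlt⟩
  · intro i x w hw
    by_contra! hne
    refine hw ?_
    have h1 : (Mstd x : X →₀ A) w = 0 := Finsupp.single_eq_of_ne hne.1
    have h2 : (Mstd (σ (cs.simple i) x) : X →₀ A) w = 0 := Finsupp.single_eq_of_ne hne.2
    split_ifs <;> simp [h1, h2]

/-- If `X` is quasiparabolic and bounded below and `β` is a bar operator on
`ℳ` (resp. `𝒩`), then for every `x ∈ X` the element `β(M_x) − M_x` is supported on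
`{w ∈ X : w < x}` in the Bruhat order. -/
theorem stmt2 (cs : CoxeterSystem M W) (σ : W → X → X) (ht : X → ℚ)
    (hact : IsActionOf σ) (hqp : IsQP cs σ ht) (hbb : BoundedBelow cs σ ht) :
    (∀ β : (X →₀ A) → (X →₀ A), IsBarOpM cs σ ht β →
      ∀ x w : X, (β (Mstd x) - Mstd x) w ≠ 0 → bruhatLT cs σ ht w x) ∧
    (∀ β : (X →₀ A) → (X →₀ A), IsBarOpN cs σ ht β →
      ∀ x w : X, (β (Mstd x) - Mstd x) w ≠ 0 → bruhatLT cs σ ht w x) := by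
  exact
    ⟨fun _ hβ _ _ => bruhatLT_of_bar_apply_ne_zero cs σ ht hact hqp hbb v hβ.2.2.1 hβ.2.2.2,
      fun _ hβ _ _ =>
        bruhatLT_of_bar_apply_ne_zero cs σ ht hact hqp hbb (-vinv) hβ.2.2.1 hβ.2.2.2⟩

end
end

section
/- Let J ⊆ S, let W_J be the subgroup of W generated by J, let X = W ⧸ W_J be the set of left cosets of W_J with the natural left W-action, and define ht : X → ℚ by ht(C) = min{ℓ(w) : w ∈ C}. Then the module ℳ built from this scaled W-set has a bar operator, and likewise the module 𝒩 has a bar operator. -/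
noncomputable section

open LaurentPolynomial

variable {B W : Type*} [Group W] {M : CoxeterMatrix B} {X : Type*}

namespace CoxeterSystem

/-- The permutation representation of `W` on `W × ℤ/2` that records parities of inversions, on
generators. -/
def inversionParityFun (cs : CoxeterSystem M W) (i : B) : Function.End (W × ZMod 2) :=
  open Classical in
  fun p => (cs.simple i * p.1 * cs.simple i, p.2 + if p.1 = cs.simple i then 1 else 0)

open Classical in
theorem prod_map_inversionParityFun (cs : CoxeterSystem M W) (ω : List B) (t : W) (ε : ZMod 2) :
    (ω.map cs.inversionParityFun).prod (t, ε) =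
      (cs.wordProd ω * t * (cs.wordProd ω)⁻¹, ε + (cs.rightInvSeq ω).count t) := by
  induction ω with
  | nil => simp; rfl
  | cons i ω ih =>
    rw [List.map_cons, List.prod_cons]
    change cs.inversionParityFun i ((ω.map cs.inversionParityFun).prod (t, ε)) = _
    rw [ih, inversionParityFun, wordProd_cons, rightInvSeq, List.count_cons]
    have h : (cs.wordProd ω * t * (cs.wordProd ω)⁻¹ = cs.simple i) ↔
        ((cs.wordProd ω)⁻¹ * cs.simple i * cs.wordProd ω = t) := by
      constructor
      · intro h; rw [← h]; group
      · intro h; rw [← h]; group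
    ext
    · simp [mul_assoc]
    · simp [h, add_assoc]

theorem prod_map_alternatingWord {N : Type*} [Monoid N] (f : B → N) (i j : B) (m : ℕ) :
    ((alternatingWord i j (2 * m)).map f).prod = (f i * f j) ^ m := by
  induction m with
  | zero => simp [alternatingWord]
  | succ m ih =>
    rw [mul_add, mul_one, alternatingWord_succ', alternatingWord_succ']
    simp [ih, pow_succ', mul_assoc]

theorem reverse_alternatingWord_two_mul (i j : B) (m : ℕ) :
    (alternatingWord i j (2 * m)).reverse = alternatingWord j i (2 * m) := by
  apply List.ext_getElem
  · simp
  · intro k h₁ h₂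
    simp only [List.length_reverse, length_alternatingWord] at h₁
    rw [List.getElem_reverse]
    simp only [length_alternatingWord]
    rw [getElem_alternatingWord _ _ _ _ (by omega), getElem_alternatingWord _ _ _ _ (by omega)]
    grind

open Classical in
theorem even_count_rightInvSeq_alternatingWord (cs : CoxeterSystem M W) (i j : B) (t : W) :
    Even ((cs.rightInvSeq (alternatingWord i j (2 * M i j))).count t) := by
  rw [← reverse_alternatingWord_two_mul, rightInvSeq_reverse, List.count_reverse]
  set L := cs.leftInvSeq (alternatingWord j i (2 * M i j)) with hL
  have hlen : L.length = 2 * M i j := by simp [hL]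
  have hper : L.take (M i j) = L.drop (M i j) := by
    apply List.ext_getElem
    · simp [hlen]; omega
    · intro k h₁ h₂
      have hk : k < M i j := by simp [hlen] at h₁; omega
      rw [List.getElem_take, List.getElem_drop]
      simp only [hL]
      rw [cs.getElem_leftInvSeq_alternatingWord j i (M i j) k (by omega),
        cs.getElem_leftInvSeq_alternatingWord j i (M i j) (M i j + k) (by omega),
        prod_alternatingWord_eq_mul_pow, prod_alternatingWord_eq_mul_pow]
      have h1 : (2 * k + 1) / 2 = k := by omega
      have h2 : (2 * (M i j + k) + 1) / 2 = M i j + k := by omega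
      rw [h1, h2, pow_add, simple_mul_simple_pow]
      simp
  rw [← List.take_append_drop (M i j) L, List.count_append, hper]
  exact ⟨_, rfl⟩

theorem isLiftable_inversionParityFun (cs : CoxeterSystem M W) :
    M.IsLiftable cs.inversionParityFun := by
  intro i j
  rw [← prod_map_alternatingWord]
  funext ⟨t, ε⟩
  classical
  rw [prod_map_inversionParityFun]
  have h : cs.wordProd (alternatingWord i j (2 * M i j)) = 1 := by
    rw [wordProd, prod_map_alternatingWord, simple_mul_simple_pow]
  rw [h, (ZMod.natCast_eq_zero_iff_even).2 (cs.even_count_rightInvSeq_alternatingWord i j t)]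
  simp only [one_mul, inv_one, mul_one, add_zero]
  rfl

/-- The exchange condition: a right descent of a reduced word occurs among its right inversions. -/
theorem mem_rightInvSeq_of_length_mul_simple_lt (cs : CoxeterSystem M W) {ω : List B} {j : B}
    (h : cs.length (cs.wordProd ω * cs.simple j) < cs.length (cs.wordProd ω)) :
    cs.simple j ∈ cs.rightInvSeq ω := by
  classical
  by_contra hmem
  let F := cs.lift ⟨_, cs.isLiftable_inversionParityFun⟩
  have hF : ∀ ω : List B, F (cs.wordProd ω) = (ω.map cs.inversionParityFun).prod := by
    intro ω
    rw [wordProd, map_list_prod, List.map_map]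
    congr 2
    funext i
    exact cs.lift_apply_simple cs.isLiftable_inversionParityFun i
  obtain ⟨ω', hω', hprod⟩ := cs.exists_isReduced (cs.wordProd ω * cs.simple j)
  have h1 : F (cs.wordProd ω' * cs.simple j) (cs.simple j, 0) =
      F (cs.wordProd ω) (cs.simple j, 0) := by
    rw [← hprod, mul_assoc, simple_mul_simple_self, mul_one]
  have h2 : F (cs.wordProd ω' * cs.simple j) (cs.simple j, 0) =
      F (cs.wordProd ω') (cs.simple j, 1) := by
    rw [map_mul]
    change F _ (F _ _) = _
    rw [show F (cs.simple j) = cs.inversionParityFun j from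
      cs.lift_apply_simple cs.isLiftable_inversionParityFun j]
    simp [inversionParityFun]
  rw [h2, hF, hF, prod_map_inversionParityFun, prod_map_inversionParityFun,
    List.count_eq_zero_of_not_mem hmem] at h1
  have h3 := congrArg Prod.snd h1
  have hmem' : cs.simple j ∈ cs.rightInvSeq ω' := by
    by_contra hn
    rw [List.count_eq_zero_of_not_mem hn] at h3
    simp at h3
  have h4 := (cs.isRightInversion_of_mem_rightInvSeq hω' hmem').2
  rw [← hprod, mul_assoc, simple_mul_simple_self, mul_one] at h4
  omega

theorem exists_eraseIdx_of_length_mul_simple_lt (cs : CoxeterSystem M W) {ω : List B} {j : B}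
    (h : cs.length (cs.wordProd ω * cs.simple j) < cs.length (cs.wordProd ω)) :
    ∃ k < ω.length, cs.wordProd ω * cs.simple j = cs.wordProd (ω.eraseIdx k) := by
  obtain ⟨k, hk, hkj⟩ := List.getElem_of_mem (cs.mem_rightInvSeq_of_length_mul_simple_lt h)
  refine ⟨k, by simpa using hk, ?_⟩
  rw [← wordProd_mul_getD_rightInvSeq, List.getD_eq_getElem _ _ hk, hkj]

theorem simple_mul_eq_mul_simple (cs : CoxeterSystem M W) {w : W} {i j : B}
    (hi : cs.length w < cs.length (cs.simple i * w))
    (hj : cs.length w < cs.length (w * cs.simple j))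
    (hij : cs.length (cs.simple i * w * cs.simple j) < cs.length (cs.simple i * w)) :
    cs.simple i * w = w * cs.simple j := by
  obtain ⟨ω, hω, rfl⟩ := cs.exists_isReduced w
  rw [← wordProd_cons] at hij
  obtain ⟨k, hk, h⟩ := cs.exists_eraseIdx_of_length_mul_simple_lt hij
  rcases k with _ | k
  · rw [List.eraseIdx_cons_zero, wordProd_cons] at h
    nth_rw 2 [← h]
    rw [mul_assoc _ (cs.simple j), simple_mul_simple_self, mul_one]
  · rw [List.eraseIdx_cons_succ, wordProd_cons, wordProd_cons, mul_assoc,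
      mul_left_cancel_iff] at h
    have := cs.length_wordProd_le (ω.eraseIdx k)
    rw [← h] at this
    rw [hω.eq] at hj
    have := List.length_eraseIdx_le ω k
    omega

/-- If `s w ≠ w t`, then multiplication by `s` on the left does not affect whether `t` is a
right descent. -/
theorem length_mul_simple_lt_iff (cs : CoxeterSystem M W) {w : W} {i j : B}
    (h : cs.simple i * w ≠ w * cs.simple j) :
    cs.length (cs.simple i * w * cs.simple j) < cs.length (cs.simple i * w) ↔
      cs.length (w * cs.simple j) < cs.length w := by
  have key : ∀ w : W, cs.simple i * w ≠ w * cs.simple j →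
      cs.length (cs.simple i * w * cs.simple j) < cs.length (cs.simple i * w) →
      cs.length (w * cs.simple j) < cs.length w := by
    intro w hne hlt
    by_contra hj
    have h1 := cs.length_mul_simple w j
    have h2 := cs.length_simple_mul w i
    have h3 := cs.length_mul_simple (cs.simple i * w) j
    have h4 := cs.length_simple_mul (w * cs.simple j) i
    rw [← mul_assoc] at h4
    by_cases hi : cs.length w < cs.length (cs.simple i * w)
    · exact hne (cs.simple_mul_eq_mul_simple hi (by omega) hlt)
    · omega
  refine ⟨key w h, fun hlt => ?_⟩
  by_contra hn
  have h3 := cs.length_mul_simple (cs.simple i * w) j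
  have := key (w * cs.simple j) (fun e => h ?_) ?_
  · simp only [simple_mul_simple_cancel_right] at this
    omega
  · simpa [← mul_assoc] using congrArg (· * cs.simple j) e
  · simp only [← mul_assoc, simple_mul_simple_cancel_right]
    omega

theorem length_simple_mul_lt_iff (cs : CoxeterSystem M W) {w : W} {i j : B}
    (h : cs.simple i * w ≠ w * cs.simple j) :
    cs.length (cs.simple i * (w * cs.simple j)) < cs.length (w * cs.simple j) ↔
      cs.length (cs.simple i * w) < cs.length w := by
  have := cs.length_mul_simple_lt_iff h
  have h1 := cs.length_mul_simple w j
  have h2 := cs.length_simple_mul w i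
  have h3 := cs.length_mul_simple (cs.simple i * w) j
  have h4 := cs.length_simple_mul (w * cs.simple j) i
  rw [← mul_assoc] at *
  omega

/-- The minimal length of an element of a left coset. -/
def minLength (cs : CoxeterSystem M W) {H : Subgroup W} (x : W ⧸ H) : ℕ :=
  sInf {n : ℕ | ∃ w : W, (QuotientGroup.mk w : W ⧸ H) = x ∧ cs.length w = n}

theorem exists_length_eq_minLength (cs : CoxeterSystem M W) {H : Subgroup W} (x : W ⧸ H) :
    ∃ w : W, (QuotientGroup.mk w : W ⧸ H) = x ∧ cs.length w = cs.minLength x := by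
  obtain ⟨w, hw⟩ := QuotientGroup.mk_surjective x
  exact Nat.sInf_mem (s := {n | ∃ w : W, (QuotientGroup.mk w : W ⧸ H) = x ∧ cs.length w = n})
    ⟨_, w, hw, rfl⟩

theorem minLength_mk_le (cs : CoxeterSystem M W) {H : Subgroup W} (w : W) :
    cs.minLength (QuotientGroup.mk w : W ⧸ H) ≤ cs.length w :=
  Nat.sInf_le ⟨w, rfl, rfl⟩

theorem minLength_simple_smul_le (cs : CoxeterSystem M W) {H : Subgroup W} (i : B) (x : W ⧸ H) :
    cs.minLength (cs.simple i • x) ≤ cs.minLength x + 1 := by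
  obtain ⟨w, rfl, hw⟩ := cs.exists_length_eq_minLength x
  have := cs.length_simple_mul w i
  have := cs.minLength_mk_le (H := H) (cs.simple i * w)
  rw [MulAction.Quotient.smul_mk, smul_eq_mul]
  omega

theorem exists_word_of_mem_closure (cs : CoxeterSystem M W) {J : Set B} {u : W}
    (hu : u ∈ Subgroup.closure (cs.simple '' J)) :
    ∃ ω : List B, (∀ i ∈ ω, i ∈ J) ∧ cs.wordProd ω = u := by
  induction hu using Subgroup.closure_induction with
  | mem x hx =>
    obtain ⟨i, hi, rfl⟩ := hx
    exact ⟨[i], by simpa using hi, by simp⟩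
  | one => exact ⟨[], by simp, by simp⟩
  | mul x y _ _ hx hy =>
    obtain ⟨ω₁, h₁, rfl⟩ := hx
    obtain ⟨ω₂, h₂, rfl⟩ := hy
    exact ⟨ω₁ ++ ω₂, by grind, cs.wordProd_append _ _⟩
  | inv x _ hx =>
    obtain ⟨ω, h, rfl⟩ := hx
    exact ⟨ω.reverse, by simpa using h, cs.wordProd_reverse _⟩

theorem wordProd_mem_closure (cs : CoxeterSystem M W) {J : Set B} {ω : List B}
    (h : ∀ i ∈ ω, i ∈ J) : cs.wordProd ω ∈ Subgroup.closure (cs.simple '' J) := by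
  refine Subgroup.list_prod_mem _ fun x hx => ?_
  obtain ⟨i, hi, rfl⟩ := List.mem_map.1 hx
  exact Subgroup.subset_closure ⟨i, h i hi, rfl⟩

theorem mk_mul_simple (cs : CoxeterSystem M W) {J : Set B} {H : Subgroup W}
    (hH : H = Subgroup.closure (cs.simple '' J)) {j : B} (hj : j ∈ J) (w : W) :
    (QuotientGroup.mk (w * cs.simple j) : W ⧸ H) = QuotientGroup.mk w :=
  QuotientGroup.mk_mul_of_mem _ (hH ▸ Subgroup.subset_closure ⟨j, hj, rfl⟩)

/-- Lengths add along a minimal coset representative times a word in `J` that is shortest among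
the words in `J` with the same product. -/
theorem length_mul_wordProd_of_minLength (cs : CoxeterSystem M W) {J : Set B} {H : Subgroup W}
    (hH : H = Subgroup.closure (cs.simple '' J)) {y : W}
    (hy : cs.length y = cs.minLength (QuotientGroup.mk y : W ⧸ H)) (ω : List B)
    (hω : ∀ i ∈ ω, i ∈ J)
    (hmin : ∀ ω' : List B, (∀ i ∈ ω', i ∈ J) → cs.wordProd ω' = cs.wordProd ω →
      ω.length ≤ ω'.length) :
    cs.length (y * cs.wordProd ω) = cs.length y + ω.length := by
  induction ω using List.reverseRecOn with
  | nil => simp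
  | append_singleton ω j ih =>
    have hωJ : ∀ i ∈ ω, i ∈ J := fun i hi => hω i (by simp [hi])
    have hjJ : j ∈ J := hω j (by simp)
    have ih := ih hωJ fun ω' h h' => by
      have := hmin (ω' ++ [j]) (by grind) (by rw [wordProd_append, wordProd_append, h'])
      simpa using this
    rw [wordProd_append, wordProd_singleton, ← mul_assoc, List.length_append, List.length_singleton]
    have hlen := cs.length_mul_simple (y * cs.wordProd ω) j
    rcases hlen with hlen | hlen
    · omega
    exfalso
    obtain ⟨ρ, hρ, rfl⟩ := cs.exists_isReduced y
    rw [← wordProd_append] at hlen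
    obtain ⟨k, hk, hkj⟩ :=
      cs.exists_eraseIdx_of_length_mul_simple_lt (ω := ρ ++ ω) (j := j) (by omega)
    by_cases hkρ : k < ρ.length
    · rw [List.eraseIdx_append_of_lt_length hkρ, wordProd_append, wordProd_append] at hkj
      have hmk : (QuotientGroup.mk (cs.wordProd (ρ.eraseIdx k)) : W ⧸ H) =
          QuotientGroup.mk (cs.wordProd ρ) := by
        have hmem := hH ▸ cs.wordProd_mem_closure hωJ
        rw [← QuotientGroup.mk_mul_of_mem _ hmem, ← hkj, cs.mk_mul_simple hH hjJ,
          QuotientGroup.mk_mul_of_mem _ hmem]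
      have h1 := cs.minLength_mk_le (H := H) (cs.wordProd (ρ.eraseIdx k))
      rw [hmk, ← hy, hρ.eq] at h1
      have h2 := cs.length_wordProd_le (ρ.eraseIdx k)
      rw [List.length_eraseIdx_of_lt hkρ] at h2
      omega
    · rw [List.eraseIdx_append_of_length_le (by omega), wordProd_append, wordProd_append,
        mul_assoc, mul_left_cancel_iff] at hkj
      have h1 := hmin (ω.eraseIdx (k - ρ.length))
        (fun i hi => hωJ i (List.mem_of_mem_eraseIdx hi)) (by rw [← hkj]; simp [wordProd_append])
      have h2 := List.length_eraseIdx_le ω (k - ρ.length)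
      simp at h1
      omega

theorem eq_or_exists_length_mul_simple_lt (cs : CoxeterSystem M W) {J : Set B} {H : Subgroup W}
    (hH : H = Subgroup.closure (cs.simple '' J)) {y w : W}
    (hy : cs.length y = cs.minLength (QuotientGroup.mk y : W ⧸ H))
    (hyw : (QuotientGroup.mk y : W ⧸ H) = QuotientGroup.mk w) :
    w = y ∨ ∃ j ∈ J, cs.length (w * cs.simple j) < cs.length w := by
  classical
  have hu : ∃ n : ℕ, ∃ ω : List B, ω.length = n ∧ (∀ i ∈ ω, i ∈ J) ∧
      cs.wordProd ω = y⁻¹ * w := by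
    obtain ⟨ω, h1, h2⟩ := cs.exists_word_of_mem_closure (hH ▸ QuotientGroup.eq.1 hyw)
    exact ⟨_, ω, rfl, h1, h2⟩
  obtain ⟨ω, hn, hω, hprod⟩ := Nat.find_spec hu
  have hlen := cs.length_mul_wordProd_of_minLength hH hy ω hω fun ω' h1 h2 =>
    hn ▸ Nat.find_min' hu ⟨ω', rfl, h1, h2.trans hprod⟩
  have hw : w = y * cs.wordProd ω := by rw [hprod]; group
  rcases List.eq_nil_or_concat ω with rfl | ⟨ω', j, rfl⟩
  · left; simpa using hw
  · right
    refine ⟨j, hω j (by simp), ?_⟩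
    rw [← hw] at hlen
    have : w * cs.simple j = y * cs.wordProd ω' := by
      rw [hw, wordProd_concat]; simp [mul_assoc]
    rw [this, hlen]
    have h1 := cs.length_mul_le y (cs.wordProd ω')
    have h2 := cs.length_wordProd_le ω'
    simp
    omega

theorem eq_of_length_eq_minLength (cs : CoxeterSystem M W) {J : Set B} {H : Subgroup W}
    (hH : H = Subgroup.closure (cs.simple '' J)) {y w : W}
    (hy : cs.length y = cs.minLength (QuotientGroup.mk y : W ⧸ H))
    (hw : cs.length w = cs.minLength (QuotientGroup.mk w : W ⧸ H))
    (hyw : (QuotientGroup.mk y : W ⧸ H) = QuotientGroup.mk w) : w = y := by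
  refine (cs.eq_or_exists_length_mul_simple_lt hH hy hyw).resolve_right ?_
  rintro ⟨j, hj, hlt⟩
  have := cs.minLength_mk_le (H := H) (w * cs.simple j)
  rw [cs.mk_mul_simple hH hj] at this
  omega

/-- Deodhar's lemma on the left action of a simple reflection on a minimal coset representative. -/
theorem deodhar (cs : CoxeterSystem M W) {J : Set B} {H : Subgroup W}
    (hH : H = Subgroup.closure (cs.simple '' J)) {w : W}
    (hw : cs.length w = cs.minLength (QuotientGroup.mk w : W ⧸ H)) (i : B) :
    cs.length (cs.simple i * w) =
        cs.minLength (QuotientGroup.mk (cs.simple i * w) : W ⧸ H) ∨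
      cs.length (cs.simple i * w) = cs.length w + 1 ∧
        ∃ j ∈ J, cs.simple i * w = w * cs.simple j := by
  have h1 := cs.minLength_simple_smul_le i (cs.simple i • (QuotientGroup.mk w : W ⧸ H))
  rw [smul_smul, simple_mul_simple_self, one_smul, MulAction.Quotient.smul_mk, smul_eq_mul] at h1
  have h2 := cs.minLength_mk_le (H := H) (cs.simple i * w)
  have h3 := cs.length_simple_mul w i
  by_cases h : cs.length (cs.simple i * w) =
      cs.minLength (QuotientGroup.mk (cs.simple i * w) : W ⧸ H)
  · exact Or.inl h
  refine Or.inr ⟨by omega, ?_⟩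
  obtain ⟨y, hyw, hy⟩ := cs.exists_length_eq_minLength
    (QuotientGroup.mk (cs.simple i * w) : W ⧸ H)
  rcases cs.eq_or_exists_length_mul_simple_lt hH (by rw [hy, hyw]) hyw with rfl | ⟨j, hj, hlt⟩
  · exact absurd hy h
  refine ⟨j, hj, cs.simple_mul_eq_mul_simple (by omega) ?_ hlt⟩
  have h4 := cs.minLength_mk_le (H := H) (w * cs.simple j)
  rw [cs.mk_mul_simple hH hj] at h4
  have h5 := cs.length_mul_simple w j
  omega

end CoxeterSystem

theorem Abar_v_sub_vinv : Abar (v - vinv) = vinv - v := by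
  simp [Abar, v, vinv]

theorem lift_Mstd {N : Type*} [AddCommMonoid N] [Module A N] (f : X → N) (x : X) :
    Finsupp.lift N A X f (Mstd x) = f x := by
  simp [Mstd]

section HeckeOperator

variable (cs : CoxeterSystem M W) (σ : W → X → X) (ht : X → ℚ)

/-- The common form of the operators `T_s` and `U_s`, which act by the scalar `q` on basis elements
whose height is fixed by `s`. -/
def heckeOp (q : A) (i : B) : (X →₀ A) →ₗ[A] (X →₀ A) :=
  Finsupp.lift (X →₀ A) A X fun x =>
    if ht x < ht (σ (cs.simple i) x) then Mstd (σ (cs.simple i) x)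
    else if ht (σ (cs.simple i) x) < ht x then Mstd (σ (cs.simple i) x) + (v - vinv) • Mstd x
    else q • Mstd x

theorem heckeOp_Mstd (q : A) (i : B) (x : X) :
    heckeOp cs σ ht q i (Mstd x) =
      if ht x < ht (σ (cs.simple i) x) then Mstd (σ (cs.simple i) x)
      else if ht (σ (cs.simple i) x) < ht x then Mstd (σ (cs.simple i) x) + (v - vinv) • Mstd x
      else q • Mstd x := by
  rw [heckeOp, lift_Mstd]

end HeckeOperator

theorem linearMap_ext_Mstd {N : Type*} [AddCommMonoid N] [Module A N]
    {f g : (X →₀ A) →ₗ[A] N} (h : ∀ x, f (Mstd x) = g (Mstd x)) : f = g :=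
  Finsupp.lhom_ext' fun x => LinearMap.ext_ring (h x)

section Regular

variable (cs : CoxeterSystem M W)

open Classical in
/-- Left multiplication by the generator `T_i` on the regular module of the Hecke algebra. -/
def leftOp (i : B) : Module.End A (W →₀ A) :=
  Finsupp.lift (W →₀ A) A W fun w =>
    Mstd (cs.simple i * w) +
      if cs.length (cs.simple i * w) < cs.length w then (v - vinv) • Mstd w else 0

open Classical in
/-- Right multiplication by the generator `T_j` on the regular module of the Hecke algebra. -/
def rightOp (j : B) : Module.End A (W →₀ A) :=
  Finsupp.lift (W →₀ A) A W fun w =>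
    Mstd (w * cs.simple j) +
      if cs.length (w * cs.simple j) < cs.length w then (v - vinv) • Mstd w else 0

open Classical in
theorem leftOp_Mstd (i : B) (w : W) :
    leftOp cs i (Mstd w) = Mstd (cs.simple i * w) +
      if cs.length (cs.simple i * w) < cs.length w then (v - vinv) • Mstd w else 0 := by
  rw [leftOp, lift_Mstd]

open Classical in
theorem rightOp_Mstd (j : B) (w : W) :
    rightOp cs j (Mstd w) = Mstd (w * cs.simple j) +
      if cs.length (w * cs.simple j) < cs.length w then (v - vinv) • Mstd w else 0 := by
  rw [rightOp, lift_Mstd]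

theorem leftOp_Mstd_of_lt {i : B} {w : W} (h : cs.length w < cs.length (cs.simple i * w)) :
    leftOp cs i (Mstd w) = Mstd (cs.simple i * w) := by
  rw [leftOp_Mstd, if_neg (by omega), add_zero]

theorem rightOp_Mstd_of_lt {j : B} {w : W} (h : cs.length w < cs.length (w * cs.simple j)) :
    rightOp cs j (Mstd w) = Mstd (w * cs.simple j) := by
  rw [rightOp_Mstd, if_neg (by omega), add_zero]

theorem leftOp_one (j : B) : leftOp cs j (Mstd 1) = rightOp cs j (Mstd 1) := by
  rw [leftOp_Mstd_of_lt cs (by simp), rightOp_Mstd_of_lt cs (by simp), one_mul, mul_one]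

theorem commute_leftOp_rightOp (i j : B) : Commute (leftOp cs i) (rightOp cs j) := by
  refine linearMap_ext_Mstd fun w => ?_
  rw [Module.End.mul_apply, Module.End.mul_apply, leftOp_Mstd, rightOp_Mstd, map_add, map_add,
    leftOp_Mstd, rightOp_Mstd, apply_ite (leftOp cs i), apply_ite (rightOp cs j), map_zero,
    map_zero, map_smul, map_smul, leftOp_Mstd, rightOp_Mstd, ← mul_assoc]
  by_cases h : cs.simple i * w = w * cs.simple j
  · have h' : cs.simple i * w * cs.simple j = w := by rw [h]; simp
    rw [h, ← h, h']
  · have h1 := cs.length_mul_simple_lt_iff h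
    have h2 := cs.length_simple_mul_lt_iff h
    rw [← mul_assoc] at h2
    simp only [h1, h2]
    split_ifs <;> (simp; try abel)

theorem leftOp_mul_self (i : B) :
    leftOp cs i * leftOp cs i = 1 + (v - vinv) • leftOp cs i := by
  refine linearMap_ext_Mstd fun w => ?_
  have hlen := cs.length_simple_mul w i
  rw [Module.End.mul_apply, LinearMap.add_apply, LinearMap.smul_apply, Module.End.one_apply]
  by_cases h : cs.length (cs.simple i * w) < cs.length w
  · simp only [leftOp_Mstd, h, map_add, map_smul, CoxeterSystem.simple_mul_simple_cancel_left,
      if_true, if_neg (by omega : ¬ cs.length w < cs.length (cs.simple i * w))]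
    simp
  · rw [leftOp_Mstd, if_neg h, add_zero, leftOp_Mstd, CoxeterSystem.simple_mul_simple_cancel_left,
      if_pos (by omega)]

/-- The operator `leftOp` as a unit. -/
def leftUnit (i : B) : (Module.End A (W →₀ A))ˣ where
  val := leftOp cs i
  inv := leftOp cs i - (v - vinv) • 1
  val_inv := LinearMap.ext fun m => by
    have h := LinearMap.congr_fun (leftOp_mul_self cs i) m
    simp only [Module.End.mul_apply, LinearMap.add_apply, LinearMap.smul_apply, LinearMap.sub_apply,
      Module.End.one_apply, map_sub, map_smul] at h ⊢
    rw [h, add_sub_cancel_right]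
  inv_val := LinearMap.ext fun m => by
    have h := LinearMap.congr_fun (leftOp_mul_self cs i) m
    simp only [Module.End.mul_apply, LinearMap.add_apply, LinearMap.smul_apply, LinearMap.sub_apply,
      Module.End.one_apply] at h ⊢
    rw [h, add_sub_cancel_right]

theorem ext_of_commute_rightOp {P Q : Module.End A (W →₀ A)}
    (hP : ∀ j, Commute P (rightOp cs j)) (hQ : ∀ j, Commute Q (rightOp cs j))
    (h : P (Mstd 1) = Q (Mstd 1)) : P = Q := by
  refine linearMap_ext_Mstd fun w => ?_
  induction w using cs.simple_induction_right with
  | one => exact h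
  | mul_simple_right w j ih =>
    have hw : Mstd (w * cs.simple j) = rightOp cs j (Mstd w) -
        if cs.length (w * cs.simple j) < cs.length w then (v - vinv) • Mstd w else 0 := by
      rw [rightOp_Mstd, add_sub_cancel_right]
    have hPR := LinearMap.congr_fun (hP j).eq (Mstd w)
    have hQR := LinearMap.congr_fun (hQ j).eq (Mstd w)
    simp only [Module.End.mul_apply] at hPR hQR
    rw [hw, map_sub, map_sub, hPR, hQR, ih]
    split_ifs <;> simp [ih]

/-- The action of the standard basis element `T_w` of the Hecke algebra on the regular module. -/
def basisUnit (w : W) : (Module.End A (W →₀ A))ˣ :=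
  ((cs.exists_isReduced w).choose.map (leftUnit cs)).prod

theorem commute_basisUnit_rightOp (w : W) (j : B) :
    Commute (basisUnit cs w : Module.End A (W →₀ A)) (rightOp cs j) := by
  rw [basisUnit]
  generalize (cs.exists_isReduced w).choose = ω
  induction ω with
  | nil => exact Commute.one_left _
  | cons i ω ih => exact (commute_leftOp_rightOp cs i j).mul_left ih

theorem prod_map_leftUnit_Mstd_one {ω : List B} (hω : cs.IsReduced ω) :
    ((ω.map (leftUnit cs)).prod : Module.End A (W →₀ A)) (Mstd 1) = Mstd (cs.wordProd ω) := by
  induction ω with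
  | nil => simp
  | cons i ω ih =>
    have hω' : cs.IsReduced ω := hω.drop 1
    rw [List.map_cons, List.prod_cons, Units.val_mul, Module.End.mul_apply, ih hω',
      CoxeterSystem.wordProd_cons]
    refine leftOp_Mstd_of_lt cs ?_
    rw [← CoxeterSystem.wordProd_cons, hω.eq, hω'.eq]
    simp

theorem basisUnit_Mstd_one (w : W) :
    (basisUnit cs w : Module.End A (W →₀ A)) (Mstd 1) = Mstd w := by
  have h := (cs.exists_isReduced w).choose_spec
  rw [basisUnit, prod_map_leftUnit_Mstd_one cs h.1, ← h.2]

theorem basisUnit_one : basisUnit cs 1 = 1 :=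
  Units.ext <| ext_of_commute_rightOp cs (commute_basisUnit_rightOp cs 1)
    (fun j => Commute.one_left _) (by rw [basisUnit_Mstd_one]; rfl)

theorem basisUnit_mul_simple {w : W} {i : B} (h : cs.length w < cs.length (w * cs.simple i)) :
    basisUnit cs (w * cs.simple i) = basisUnit cs w * leftUnit cs i := by
  refine Units.ext <| ext_of_commute_rightOp cs (commute_basisUnit_rightOp cs _)
    (fun j => (commute_basisUnit_rightOp cs w j).mul_left (commute_leftOp_rightOp cs i j)) ?_
  rw [basisUnit_Mstd_one, Units.val_mul, Module.End.mul_apply]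
  change _ = (basisUnit cs w : Module.End A (W →₀ A)) (leftOp cs i (Mstd 1))
  have := LinearMap.congr_fun (commute_basisUnit_rightOp cs w i).eq (Mstd 1)
  rw [Module.End.mul_apply, Module.End.mul_apply, basisUnit_Mstd_one] at this
  rw [leftOp_one, this, rightOp_Mstd_of_lt cs h]

theorem basisUnit_simple_mul {w : W} {i : B} (h : cs.length w < cs.length (cs.simple i * w)) :
    basisUnit cs (cs.simple i * w) = leftUnit cs i * basisUnit cs w := by
  refine Units.ext <| ext_of_commute_rightOp cs (commute_basisUnit_rightOp cs _)
    (fun j => (commute_leftOp_rightOp cs i j).mul_left (commute_basisUnit_rightOp cs w j)) ?_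
  rw [basisUnit_Mstd_one, Units.val_mul, Module.End.mul_apply, basisUnit_Mstd_one]
  exact (leftOp_Mstd_of_lt cs h).symm

/-- The image of `T_w` under the bar involution of the Hecke algebra. -/
def barBasis (w : W) : W →₀ A :=
  ((basisUnit cs w⁻¹)⁻¹ : (Module.End A (W →₀ A))ˣ).val (Mstd 1)

theorem barBasis_one : barBasis cs 1 = Mstd 1 := by
  simp [barBasis, basisUnit_one]

theorem barBasis_simple_mul {w : W} {i : B} (h : cs.length w < cs.length (cs.simple i * w)) :
    barBasis cs (cs.simple i * w) =
      leftOp cs i (barBasis cs w) - (v - vinv) • barBasis cs w := by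
  have h' : cs.length w⁻¹ < cs.length (w⁻¹ * cs.simple i) := by
    rw [← cs.length_inv (w⁻¹ * cs.simple i)]
    simpa using h
  rw [barBasis, mul_inv_rev, CoxeterSystem.inv_simple, basisUnit_mul_simple cs h', mul_inv_rev]
  rfl

theorem barBasis_mul_simple {w : W} {j : B} (h : cs.length w < cs.length (w * cs.simple j)) :
    barBasis cs (w * cs.simple j) =
      rightOp cs j (barBasis cs w) - (v - vinv) • barBasis cs w := by
  have h' : cs.length w⁻¹ < cs.length (cs.simple j * w⁻¹) := by
    rw [← cs.length_inv (cs.simple j * w⁻¹)]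
    simpa using h
  rw [barBasis, mul_inv_rev, CoxeterSystem.inv_simple, basisUnit_simple_mul cs h', mul_inv_rev,
    Units.val_mul, Module.End.mul_apply]
  have h1 : ((leftUnit cs j)⁻¹ : (Module.End A (W →₀ A))ˣ).val (Mstd 1) =
      rightOp cs j (Mstd 1) - (v - vinv) • Mstd 1 := by
    rw [← leftOp_one]; rfl
  have h2 := LinearMap.congr_fun (commute_basisUnit_rightOp cs w⁻¹ j).units_inv_left.eq (Mstd 1)
  rw [Module.End.mul_apply, Module.End.mul_apply] at h2
  rw [h1, map_sub, map_smul, h2]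
  rfl

end Regular

section Parabolic

variable (cs : CoxeterSystem M W) {J : Set B} {H : Subgroup W}

/-- The operator `heckeOp` on the module of the parabolic quotient `W ⧸ H`. -/
abbrev cosetOp (H : Subgroup W) (q : A) (i : B) : (W ⧸ H →₀ A) →ₗ[A] (W ⧸ H →₀ A) :=
  heckeOp cs (fun (w : W) (x : W ⧸ H) => w • x) (fun x => (cs.minLength x : ℚ)) q i

theorem cosetOp_Mstd_mk (q : A) (i : B) (w : W) :
    cosetOp cs H q i (Mstd (QuotientGroup.mk w)) =
      if cs.minLength (QuotientGroup.mk w : W ⧸ H) <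
          cs.minLength (QuotientGroup.mk (cs.simple i * w) : W ⧸ H) then
        Mstd (QuotientGroup.mk (cs.simple i * w))
      else if cs.minLength (QuotientGroup.mk (cs.simple i * w) : W ⧸ H) <
          cs.minLength (QuotientGroup.mk w : W ⧸ H) then
        Mstd (QuotientGroup.mk (cs.simple i * w)) + (v - vinv) • Mstd (QuotientGroup.mk w)
      else q • Mstd (QuotientGroup.mk w) := by
  rw [cosetOp, heckeOp_Mstd]
  simp only [Nat.cast_lt, MulAction.Quotient.smul_mk, smul_eq_mul]

/-- The projection from the regular module to the parabolic module on which the generators in `J`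
act on the right by `q`. -/
def cosetProj (H : Subgroup W) (q : A) : (W →₀ A) →ₗ[A] (W ⧸ H →₀ A) :=
  Finsupp.lift (W ⧸ H →₀ A) A W fun w =>
    q ^ (cs.length w - cs.minLength (QuotientGroup.mk w : W ⧸ H)) • Mstd (QuotientGroup.mk w)

theorem cosetProj_Mstd (q : A) (w : W) :
    cosetProj cs H q (Mstd w) =
      q ^ (cs.length w - cs.minLength (QuotientGroup.mk w : W ⧸ H)) •
        Mstd (QuotientGroup.mk w) := by
  rw [cosetProj, lift_Mstd]

theorem cosetProj_Mstd_of_minLength (q : A) {w : W}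
    (hw : cs.length w = cs.minLength (QuotientGroup.mk w : W ⧸ H)) :
    cosetProj cs H q (Mstd w) = Mstd (QuotientGroup.mk w) := by
  rw [cosetProj_Mstd, hw, Nat.sub_self, pow_zero, one_smul]

variable {q : A} (hq : q * q = 1 + (v - vinv) * q) (hH : H = Subgroup.closure (cs.simple '' J))
include hq hH

theorem cosetProj_rightOp {j : B} (hj : j ∈ J) (m : W →₀ A) :
    cosetProj cs H q (rightOp cs j m) = q • cosetProj cs H q m := by
  suffices h : cosetProj cs H q ∘ₗ rightOp cs j = q • cosetProj cs H q from
    LinearMap.congr_fun h m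
  refine linearMap_ext_Mstd fun w => ?_
  have h1 := cs.length_mul_simple w j
  have h2 := cs.minLength_mk_le (H := H) w
  have h3 := cs.minLength_mk_le (H := H) (w * cs.simple j)
  rw [LinearMap.comp_apply, LinearMap.smul_apply, rightOp_Mstd, map_add,
    apply_ite (cosetProj cs H q), map_smul, map_zero, cosetProj_Mstd, cosetProj_Mstd,
    cs.mk_mul_simple hH hj]
  rw [cs.mk_mul_simple hH hj] at h3
  rcases h1 with h1 | h1
  · rw [if_neg (by omega), add_zero, smul_smul, h1, Nat.sub_add_comm h2, pow_succ']
  · rw [if_pos (by omega), ← h1, Nat.sub_add_comm h3, pow_succ', smul_smul, smul_smul, ← add_smul]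
    congr 1
    linear_combination - q ^ (cs.length (w * cs.simple j) -
      cs.minLength (QuotientGroup.mk w : W ⧸ H)) * hq

theorem cosetProj_leftOp (i : B) (m : W →₀ A) :
    cosetProj cs H q (leftOp cs i m) = cosetOp cs H q i (cosetProj cs H q m) := by
  suffices h : cosetProj cs H q ∘ₗ leftOp cs i = cosetOp cs H q i ∘ₗ cosetProj cs H q from
    LinearMap.congr_fun h m
  refine linearMap_ext_Mstd fun w => ?_
  rw [LinearMap.comp_apply, LinearMap.comp_apply]
  induction hn : cs.length w using Nat.strong_induction_on generalizing w with
  | _ n ih =>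
    subst hn
    obtain ⟨y, hyw, hy⟩ := cs.exists_length_eq_minLength (QuotientGroup.mk w : W ⧸ H)
    rcases cs.eq_or_exists_length_mul_simple_lt hH (by rw [hy, hyw]) hyw with rfl | ⟨j, hj, hlt⟩
    · have h1 := cs.length_simple_mul w i
      rw [cosetProj_Mstd_of_minLength cs q hy, leftOp_Mstd, map_add,
        apply_ite (cosetProj cs H q), map_smul, map_zero, cosetProj_Mstd_of_minLength cs q hy,
        cosetOp_Mstd_mk, ← hy]
      rcases cs.deodhar hH hy i with h | ⟨h, j, hj, hij⟩
      · rw [cosetProj_Mstd_of_minLength cs q h, ← h]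
        rcases h1 with h1 | h1
        · rw [if_neg (by omega), if_pos (by omega), add_zero]
        · rw [if_pos (by omega), if_neg (by omega), if_pos (by omega)]
      · rw [cosetProj_Mstd, h, hij, cs.mk_mul_simple hH hj, ← hy, if_neg (by omega),
          if_neg (by omega), if_neg (by omega), Nat.add_sub_cancel_left, pow_one, add_zero]
    · have hw : Mstd w = rightOp cs j (Mstd (w * cs.simple j)) := by
        rw [rightOp_Mstd_of_lt cs (by simpa using hlt)]
        simp
      have hc := LinearMap.congr_fun (commute_leftOp_rightOp cs i j).eq
        (Mstd (w * cs.simple j))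
      simp only [Module.End.mul_apply] at hc
      rw [hw, hc, cosetProj_rightOp cs hq hH hj, cosetProj_rightOp cs hq hH hj, map_smul,
        ih _ hlt _ rfl]

omit hq hH in
/-- The image of a standard basis element of the parabolic module under its bar operator. -/
def cosetBarBasis (q : A) (x : W ⧸ H) : W ⧸ H →₀ A :=
  cosetProj cs H q (barBasis cs (cs.exists_length_eq_minLength x).choose)

omit hq in
theorem cosetBarBasis_mk {w : W}
    (hw : cs.length w = cs.minLength (QuotientGroup.mk w : W ⧸ H)) :
    cosetBarBasis cs q (QuotientGroup.mk w : W ⧸ H) = cosetProj cs H q (barBasis cs w) := by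
  have h := (cs.exists_length_eq_minLength (QuotientGroup.mk w : W ⧸ H)).choose_spec
  rw [cosetBarBasis, cs.eq_of_length_eq_minLength hH hw (by rw [h.2, h.1]) h.1.symm]

omit hq hH in
/-- The semilinear extension of `cosetBarBasis`. -/
def cosetBar (q : A) (m : W ⧸ H →₀ A) : W ⧸ H →₀ A :=
  m.sum fun x a => Abar a • cosetBarBasis cs q x

omit hq hH in
theorem cosetBar_add (m m' : W ⧸ H →₀ A) :
    cosetBar cs q (m + m') = cosetBar cs q m + cosetBar cs q m' :=
  Finsupp.sum_add_index' (by simp [Abar]) (by simp [Abar, add_smul])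

omit hq hH in
theorem cosetBar_smul (f : A) (m : W ⧸ H →₀ A) :
    cosetBar cs q (f • m) = Abar f • cosetBar cs q m := by
  rw [cosetBar, Finsupp.sum_smul_index (by simp [Abar]), cosetBar, Finsupp.smul_sum]
  simp [Abar, mul_smul]

omit hq hH in
theorem cosetBar_Mstd (x : W ⧸ H) : cosetBar cs q (Mstd x) = cosetBarBasis cs q x := by
  rw [cosetBar, Mstd, Finsupp.sum_single_index (by simp [Abar])]
  simp [Abar]

theorem cosetBar_cosetOp_Mstd (hbar : Abar q = q - (v - vinv)) (i : B) (x : W ⧸ H) :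
    cosetBar cs q (cosetOp cs H q i (Mstd x)) =
      cosetOp cs H q i (cosetBar cs q (Mstd x)) + (vinv - v) • cosetBar cs q (Mstd x) := by
  obtain ⟨w, rfl, hw⟩ := cs.exists_length_eq_minLength x
  have h1 := cs.length_simple_mul w i
  rw [cosetOp_Mstd_mk, ← hw, cosetBar_Mstd, cosetBarBasis_mk cs hH hw, ← cosetProj_leftOp cs hq hH,
    ← map_smul, ← map_add]
  rcases cs.deodhar hH hw i with h | ⟨h, j, hj, hij⟩
  · rw [← h]
    rcases h1 with h1 | h1
    · rw [if_pos (by omega), cosetBar_Mstd, cosetBarBasis_mk cs hH h,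
        barBasis_simple_mul cs (by omega), ← neg_sub v vinv, neg_smul, sub_eq_add_neg]
    · have h2 := barBasis_simple_mul cs (w := cs.simple i * w) (i := i)
        (by rw [CoxeterSystem.simple_mul_simple_cancel_left]; omega)
      have h3 := LinearMap.congr_fun (leftOp_mul_self cs i) (barBasis cs (cs.simple i * w))
      simp only [Module.End.mul_apply, LinearMap.add_apply, LinearMap.smul_apply,
        Module.End.one_apply] at h3
      rw [CoxeterSystem.simple_mul_simple_cancel_left] at h2
      rw [if_neg (by omega), if_pos (by omega), cosetBar_add, cosetBar_smul, cosetBar_Mstd,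
        cosetBar_Mstd, cosetBarBasis_mk cs hH h, cosetBarBasis_mk cs hH hw, Abar_v_sub_vinv,
        ← map_smul, ← map_add]
      congr 2
      rw [h2, map_sub, map_smul, h3, add_sub_cancel_right]
  · rw [hij, cs.mk_mul_simple hH hj, ← hw, if_neg (by omega), if_neg (by omega), cosetBar_smul,
      cosetBar_Mstd, cosetBarBasis_mk cs hH hw, hbar, sub_smul, ← cosetProj_rightOp cs hq hH hj,
      ← map_smul, ← map_sub, ← barBasis_mul_simple cs (by rw [← hij]; omega), ← hij,
      barBasis_simple_mul cs (by omega), ← neg_sub v vinv, neg_smul, sub_eq_add_neg]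

theorem cosetBar_cosetOp (hbar : Abar q = q - (v - vinv)) (i : B) (m : W ⧸ H →₀ A) :
    cosetBar cs q (cosetOp cs H q i m) =
      cosetOp cs H q i (cosetBar cs q m) + (vinv - v) • cosetBar cs q m := by
  induction m using Finsupp.induction_linear with
  | zero => simp [cosetBar]
  | add m m' h h' =>
    rw [map_add, cosetBar_add, cosetBar_add, h, h', map_add, smul_add]
    abel
  | single x a =>
    have hx : Finsupp.single x a = a • Mstd x := by simp [Mstd]
    rw [hx, map_smul, cosetBar_smul, cosetBar_smul, cosetBar_cosetOp_Mstd cs hq hH hbar, map_smul,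
      smul_add, smul_comm]

omit hq in
theorem cosetBar_Mstd_of_wMin {x : W ⧸ H}
    (hx : WMin cs (fun (w : W) (x : W ⧸ H) => w • x) (fun x => (cs.minLength x : ℚ)) x) :
    cosetBar cs q (Mstd x) = Mstd x := by
  obtain ⟨w, rfl, hw⟩ := cs.exists_length_eq_minLength x
  have hw1 : w = 1 := by
    by_contra hne
    obtain ⟨i, hi⟩ := cs.exists_leftDescent_of_ne_one hne
    have h1 := hx i
    have h2 := cs.minLength_mk_le (H := H) (cs.simple i * w)
    simp only [Nat.cast_le, MulAction.Quotient.smul_mk, smul_eq_mul] at h1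
    rw [CoxeterSystem.IsLeftDescent] at hi
    omega
  subst hw1
  rw [cosetBar_Mstd, cosetBarBasis_mk cs hH hw, barBasis_one, cosetProj_Mstd_of_minLength cs q hw]

end Parabolic

theorem v_mul_vinv : v * vinv = 1 := by
  rw [v, vinv, ← LaurentPolynomial.T_add]
  exact LaurentPolynomial.T_zero

theorem Abar_v : Abar v = vinv := by
  simp [Abar, v, vinv]

theorem Abar_neg_vinv : Abar (-vinv) = -v := by
  simp [Abar, v, vinv]

/-- Let `J ⊆ S`, let `W_J` be the standard parabolic subgroup generated by `J`,
and let `X = W ⧸ W_J` with the natural left `W`-action and height function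
`ht(C) = min {ℓ(w) : w ∈ C}`. Then both `ℳ` and `𝒩` admit bar operators. -/
theorem stmt9 (cs : CoxeterSystem M W) (J : Set B) :
    ∀ (H : Subgroup W), H = Subgroup.closure (cs.simple '' J) →
    ∀ (σ : W → (W ⧸ H) → (W ⧸ H)), σ = (fun w q => w • q) →
    ∀ (ht : (W ⧸ H) → ℚ),
      ht = (fun q =>
        ((sInf {n : ℕ | ∃ w : W, (QuotientGroup.mk w : W ⧸ H) = q ∧ cs.length w = n} : ℕ) : ℚ)) →
    (∃ β : ((W ⧸ H) →₀ A) → ((W ⧸ H) →₀ A), IsBarOpM cs σ ht β) ∧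
    (∃ β : ((W ⧸ H) →₀ A) → ((W ⧸ H) →₀ A), IsBarOpN cs σ ht β) := by
  rintro H hH σ rfl ht rfl
  refine ⟨⟨cosetBar cs v, cosetBar_add cs, cosetBar_smul cs, cosetBar_cosetOp cs ?_ hH ?_,
    fun x hx => cosetBar_Mstd_of_wMin cs hH hx⟩,
    ⟨cosetBar cs (-vinv), cosetBar_add cs, cosetBar_smul cs, cosetBar_cosetOp cs ?_ hH ?_,
    fun x hx => cosetBar_Mstd_of_wMin cs hH hx⟩⟩
  · linear_combination v_mul_vinv
  · rw [Abar_v]; ring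
  · linear_combination v_mul_vinv
  · rw [Abar_neg_vinv]; ring

end
end
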